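/- arXiv:0812.1005 — 2 statements merged into one kernel-verified Lean document; each statement's English description precedes it below -/
import Mathlib

section
/- For every 1 ≤ j ≤ N and every γ ∈ (ℂ∖{0})^N satisfying q^{m+1} k² γ_i/γ_{i'} ≠ 1 for all 1 ≤ i < i' ≤ N and all integers m ≥ 0, the function K satisfies the q-difference equation ( ∏_{1 ≤ r ≤ j < s ≤ N} (1 − q γ_r/γ_s)/(1 − q k² γ_r/γ_s) ) · K(q^{ϖ_j} γ) = K(γ). (The hypothesis on γ guarantees that all denominators occurring, including those in K(q^{ϖ_j}γ), are nonzero.) -/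
/-- The `q`-shifted factorial `(z; q)_∞ = ∏_{m ≥ 0} (1 - q^m z)`. -/
noncomputable def qPochhammerInf (q : ℝ) (z : ℂ) : ℂ := ∏' m : ℕ, (1 - (q : ℂ) ^ m * z)

/-- `K(γ) = ∏_{1 ≤ i < j ≤ N} (q γ_i/γ_j; q)_∞ / (q k² γ_i/γ_j; q)_∞`. -/
noncomputable def Kfun (N : ℕ) (q : ℝ) (k : ℂ) (γ : Fin N → ℂ) : ℂ :=
  ∏ i : Fin N, ∏ j : Fin N,
    if i < j then
      qPochhammerInf q ((q : ℂ) * γ i / γ j) / qPochhammerInf q ((q : ℂ) * k ^ 2 * γ i / γ j)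
    else 1

theorem multipliable_one_sub_pow_mul {q : ℝ} (hq0 : 0 < q) (hq1 : q < 1) (z : ℂ) :
    Multipliable fun m : ℕ => 1 - (q : ℂ) ^ m * z := by
  simp only [sub_eq_add_neg]
  apply multipliable_one_add_of_summable
  simp only [norm_neg, norm_mul, norm_pow, Complex.norm_real, Real.norm_of_nonneg hq0.le]
  exact (summable_geometric_of_lt_one hq0.le hq1).mul_right _

theorem qPochhammerInf_eq_one_sub_mul {q : ℝ} (hq0 : 0 < q) (hq1 : q < 1) (z : ℂ) :
    qPochhammerInf q z = (1 - z) * qPochhammerInf q (q * z) := by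
  have key : ∀ m : ℕ, 1 - (q : ℂ) ^ (m + 1) * z = 1 - (q : ℂ) ^ m * (q * z) := fun m => by ring
  unfold qPochhammerInf
  rw [tprod_eq_zero_mul']
  · simp only [key, pow_zero, one_mul]
  · simpa only [key] using multipliable_one_sub_pow_mul hq0 hq1 (q * z)

/-- The `q`-difference equations for `K`: for `1 ≤ j ≤ N` and `γ ∈ (ℂ∖{0})^N` with
`q^{m+1} k² γ_i/γ_{i'} ≠ 1` for all `i < i'` and all `m ≥ 0`,
`(∏_{1 ≤ r ≤ j < s ≤ N} (1 - q γ_r/γ_s)/(1 - q k² γ_r/γ_s)) K(q^{ϖ_j} γ) = K(γ)`,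
where `q^{ϖ_j} γ` multiplies the first `j` components of `γ` by `q`.
(In 0-based labels, `1 ≤ r ≤ j < s ≤ N` becomes `r < j ∧ j ≤ s`.) -/
theorem K_difference_equations (N : ℕ) (hN : 2 ≤ N) (q : ℝ) (hq0 : 0 < q) (hq1 : q < 1)
    (k : ℂ) (hk : k ≠ 0) (j : ℕ) (hj1 : 1 ≤ j) (hjN : j ≤ N)
    (γ : Fin N → ℂ) (hγ : ∀ i, γ i ≠ 0)
    (hreg : ∀ (m : ℕ) (i i' : Fin N), i < i' →
      (q : ℂ) ^ (m + 1) * k ^ 2 * γ i / γ i' ≠ 1) :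
    (∏ r : Fin N, ∏ s : Fin N,
        if (r : ℕ) < j ∧ j ≤ (s : ℕ) then
          (1 - (q : ℂ) * γ r / γ s) / (1 - (q : ℂ) * k ^ 2 * γ r / γ s)
        else 1) *
      Kfun N q k (fun i => if (i : ℕ) < j then (q : ℂ) * γ i else γ i) = Kfun N q k γ := by
  have hq : (q : ℂ) ≠ 0 := by exact_mod_cast hq0.ne'
  unfold Kfun
  simp only [← Finset.prod_mul_distrib]
  refine Finset.prod_congr rfl fun r _ => Finset.prod_congr rfl fun s _ => ?_
  by_cases hrs : r < s
  · have hrs' : (r : ℕ) < s := hrs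
    simp only [hrs, if_true]
    by_cases hs : (s : ℕ) < j
    · have hr : (r : ℕ) < j := hrs'.trans hs
      have cancel : ∀ c : ℂ, c * (q * γ r) / (q * γ s) = c * γ r / γ s := fun c => by
        rw [mul_left_comm, mul_div_mul_left _ _ hq]
      simp only [hr, hs, not_le.mpr hs, and_false, if_true, if_false, one_mul, cancel]
    · by_cases hr : (r : ℕ) < j
      · have shift : ∀ c : ℂ, c * (q * γ r) / γ s = q * (c * γ r / γ s) := fun c => by ring
        simp only [hr, hs, not_lt.mp hs, and_self, if_true, if_false, shift]
        rw [qPochhammerInf_eq_one_sub_mul hq0 hq1 (q * γ r / γ s),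
          qPochhammerInf_eq_one_sub_mul hq0 hq1 (q * k ^ 2 * γ r / γ s), mul_div_mul_comm]
      · simp only [hr, hs, false_and, if_false, one_mul]
  · have h : ¬((r : ℕ) < j ∧ j ≤ (s : ℕ)) := fun h => hrs (h.1.trans_le h.2)
    simp only [hrs, h, if_false, mul_one]
end

section
/- One has π̂ ∘ T̂_i ∘ π̂^{−1} = T̂_{i+1} as operators on F for every 1 ≤ i ≤ N−2. Moreover, setting T̂_0 := π̂ ∘ T̂_{N−1} ∘ π̂^{−1}, the operator T̂_0 satisfies the quadratic relation (T̂_0 − k·id)(T̂_0 + k^{−1}·id) = 0, and if N ≥ 3 the affine braid relations hold: T̂_0 T̂_1 T̂_0 = T̂_1 T̂_0 T̂_1, T̂_0 T̂_{N−1} T̂_0 = T̂_{N−1} T̂_0 T̂_{N−1}, and T̂_0 T̂_j = T̂_j T̂_0 for every 2 ≤ j ≤ N−2. -/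
/-- `F := ℂ(x_1, …, x_N)`, the field of fractions of the (Laurent) polynomial ring. -/
abbrev RatF (N : ℕ) := FractionRing (MvPolynomial (Fin N) ℂ)

/-- The coordinate `x_i ∈ F`. -/
noncomputable def Xv (N : ℕ) (i : Fin N) : RatF N :=
  algebraMap (MvPolynomial (Fin N) ℂ) (RatF N) (MvPolynomial.X i)

/-- The scalar `c ∈ ℂ` viewed in `F`. -/
noncomputable def Cc (N : ℕ) (c : ℂ) : RatF N :=
  algebraMap (MvPolynomial (Fin N) ℂ) (RatF N) (MvPolynomial.C c)

/-- The adjacent transposition of `i` and `i+1` in `S_N` (0-based labels `0, …, N-1`). -/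
def sw (N i : ℕ) : Equiv.Perm (Fin N) :=
  if h : i + 1 < N then Equiv.swap ⟨i, Nat.lt_of_succ_lt h⟩ ⟨i + 1, h⟩ else 1

/-- `act` is the action of `S_N` on `F` by field automorphisms, `w` acting by the
substitution `x_j ↦ x_{w(j)}` (and fixing the scalars `ℂ`). -/
def IsStdAction (N : ℕ) (act : Equiv.Perm (Fin N) →* RingAut (RatF N)) : Prop :=
  (∀ (w : Equiv.Perm (Fin N)) (j : Fin N), act w (Xv N j) = Xv N (w j)) ∧
  (∀ (w : Equiv.Perm (Fin N)) (c : ℂ), act w (Cc N c) = Cc N c)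

/-- The Demazure–Lusztig operator
`T̂_i f := k f + c_k(x_i/x_{i+1}) (s_i f - f)`, where
`c_k(x_i/x_{i+1}) = (k⁻¹ x_{i+1} - k x_i)/(x_{i+1} - x_i)` (0-based labels). -/
noncomputable def DL (N : ℕ) (k : ℂ) (act : Equiv.Perm (Fin N) →* RingAut (RatF N))
    (i : ℕ) (f : RatF N) : RatF N :=
  if h : i + 1 < N then
    Cc N k * f +
      (Cc N k⁻¹ * Xv N ⟨i + 1, h⟩ - Cc N k * Xv N ⟨i, Nat.lt_of_succ_lt h⟩) /
          (Xv N ⟨i + 1, h⟩ - Xv N ⟨i, Nat.lt_of_succ_lt h⟩) *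
        (act (sw N i) f - f)
  else f

section DemazureLusztig

variable {K : Type*} [Field K]

/-- The operator `f ↦ κ f + (μ b - κ a) / (b - a) (s f - f)` attached to an automorphism `s`. -/
def demazureLusztig (κ μ : K) (s : RingAut K) (a b f : K) : K :=
  κ * f + (μ * b - κ * a) / (b - a) * (s f - f)

theorem demazureLusztig_mul_left {l : K} (hl : l ≠ 0) (κ μ : K) (s : RingAut K) (a b f : K) :
    demazureLusztig κ μ s (l * a) (l * b) f = demazureLusztig κ μ s a b f := by
  have h1 : μ * (l * b) - κ * (l * a) = l * (μ * b - κ * a) := by ring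
  have h2 : l * b - l * a = l * (b - a) := by ring
  rw [demazureLusztig, demazureLusztig, h1, h2, mul_div_mul_left _ _ hl]

theorem map_demazureLusztig (p : RingAut K) {κ μ : K} (hκ : p κ = κ) (hμ : p μ = μ)
    (s : RingAut K) (a b f : K) :
    p (demazureLusztig κ μ s a b (p⁻¹ f)) =
      demazureLusztig κ μ (p * s * p⁻¹) (p a) (p b) f := by
  have h : p (p⁻¹ f) = f := p.apply_symm_apply f
  simp only [demazureLusztig, map_add, map_mul, map_div₀, map_sub, hκ, hμ, h, RingAut.mul_apply]

theorem demazureLusztig_quadratic {κ μ : K} {s : RingAut K} {a b : K}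
    (hκ : s κ = κ) (hμ : s μ = μ) (hs : s * s = 1) (ha : s a = b) (hb : s b = a) (hab : a ≠ b)
    (f : K) :
    demazureLusztig κ μ s a b (demazureLusztig κ μ s a b f + μ * f)
      - κ * (demazureLusztig κ μ s a b f + μ * f) = 0 := by
  have hss : s (s f) = f := by simpa using DFunLike.congr_fun hs f
  have h1 : a - b ≠ 0 := sub_ne_zero.2 hab
  have h2 : b - a ≠ 0 := sub_ne_zero.2 hab.symm
  simp only [demazureLusztig, map_add, map_mul, map_div₀, map_sub, hκ, hμ, hss, ha, hb]
  field_simp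
  ring

theorem demazureLusztig_braid {κ μ : K} {s t : RingAut K} {a b c : K}
    (hsκ : s κ = κ) (hsμ : s μ = μ) (htκ : t κ = κ) (htμ : t μ = μ)
    (hs : s * s = 1) (ht : t * t = 1) (hst : s * t * s = t * s * t)
    (hsa : s a = b) (hsb : s b = a) (hsc : s c = c)
    (hta : t a = a) (htb : t b = c) (htc : t c = b)
    (hab : a ≠ b) (hbc : b ≠ c) (hac : a ≠ c) (f : K) :
    demazureLusztig κ μ s a b (demazureLusztig κ μ t b c (demazureLusztig κ μ s a b f)) =
      demazureLusztig κ μ t b c (demazureLusztig κ μ s a b (demazureLusztig κ μ t b c f)) := by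
  have hss : ∀ g, s (s g) = g := fun g => by simpa using DFunLike.congr_fun hs g
  have htt : ∀ g, t (t g) = g := fun g => by simpa using DFunLike.congr_fun ht g
  have hsts : s (t (s f)) = t (s (t f)) := by simpa using DFunLike.congr_fun hst f
  have h1 : a - b ≠ 0 := sub_ne_zero.2 hab
  have h2 : b - a ≠ 0 := sub_ne_zero.2 hab.symm
  have h3 : b - c ≠ 0 := sub_ne_zero.2 hbc
  have h4 : c - b ≠ 0 := sub_ne_zero.2 hbc.symm
  have h5 : a - c ≠ 0 := sub_ne_zero.2 hac
  have h6 : c - a ≠ 0 := sub_ne_zero.2 hac.symm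
  simp only [demazureLusztig, map_add, map_mul, map_div₀, map_sub, hsκ, hsμ, htκ, htμ, hss, htt,
    hsts, hsa, hsb, hsc, hta, htb, htc]
  field_simp
  ring

theorem demazureLusztig_comm {κ μ : K} {s t : RingAut K} {a b c d : K}
    (hsκ : s κ = κ) (hsμ : s μ = μ) (htκ : t κ = κ) (htμ : t μ = μ)
    (hst : s * t = t * s) (hsc : s c = c) (hsd : s d = d) (hta : t a = a) (htb : t b = b) (f : K) :
    demazureLusztig κ μ s a b (demazureLusztig κ μ t c d f) =
      demazureLusztig κ μ t c d (demazureLusztig κ μ s a b f) := by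
  have h : s (t f) = t (s f) := by simpa using DFunLike.congr_fun hst f
  simp only [demazureLusztig, map_add, map_mul, map_div₀, map_sub, hsκ, hsμ, htκ, htμ,
    h, hsc, hsd, hta, htb]
  ring

end DemazureLusztig

theorem ratF_ringAut_ext {N : ℕ} {σ τ : RingAut (RatF N)}
    (hC : ∀ c, σ (Cc N c) = τ (Cc N c)) (hX : ∀ j, σ (Xv N j) = τ (Xv N j)) : σ = τ := by
  have h : (σ : RatF N →+* RatF N) = (τ : RatF N →+* RatF N) := by
    apply IsLocalization.ringHom_ext (nonZeroDivisors (MvPolynomial (Fin N) ℂ))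
    apply MvPolynomial.ringHom_ext
    · exact hC
    · exact hX
  exact RingEquiv.ext fun x => RingHom.congr_fun h x

theorem Xv_ne_Cc_mul_Xv {N : ℕ} {i j : Fin N} (h : i ≠ j) (c : ℂ) :
    Xv N i ≠ Cc N c * Xv N j := by
  intro he
  rw [Xv, Xv, Cc, ← map_mul] at he
  have h1 := IsFractionRing.injective (MvPolynomial (Fin N) ℂ) (RatF N) he
  have h2 := congrArg (MvPolynomial.eval (Pi.single i (1 : ℂ))) h1
  simp [h.symm] at h2

theorem Cc_one (N : ℕ) : Cc N 1 = 1 := by simp [Cc]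

theorem Cc_mul (N : ℕ) (c d : ℂ) : Cc N (c * d) = Cc N c * Cc N d := by simp [Cc]

theorem Xv_injective (N : ℕ) : Function.Injective (Xv N) := by
  intro i j h
  by_contra hij
  exact Xv_ne_Cc_mul_Xv hij 1 (by rw [Cc_one, one_mul, h])

theorem DL_eq_demazureLusztig {N : ℕ} (k : ℂ) (act : Equiv.Perm (Fin N) →* RingAut (RatF N))
    {i : ℕ} (h : i + 1 < N) (f : RatF N) :
    DL N k act i f = demazureLusztig (Cc N k) (Cc N k⁻¹) (act (sw N i))
      (Xv N ⟨i, Nat.lt_of_succ_lt h⟩) (Xv N ⟨i + 1, h⟩) f := by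
  rw [DL, dif_pos h, demazureLusztig]

theorem sw_mul_self (N i : ℕ) : sw N i * sw N i = 1 := by
  unfold sw
  split_ifs <;> simp

theorem sw_apply_left {N i : ℕ} (h : i + 1 < N) : sw N i ⟨i, Nat.lt_of_succ_lt h⟩ = ⟨i + 1, h⟩ := by
  simp [sw, h]

theorem sw_apply_right {N i : ℕ} (h : i + 1 < N) :
    sw N i ⟨i + 1, h⟩ = ⟨i, Nat.lt_of_succ_lt h⟩ := by
  simp [sw, h]

theorem sw_apply_of_ne {N i : ℕ} {j : Fin N} (h1 : (j : ℕ) ≠ i) (h2 : (j : ℕ) ≠ i + 1) :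
    sw N i j = j := by
  unfold sw
  split_ifs
  · exact Equiv.swap_apply_of_ne_of_ne (by simpa [Fin.ext_iff] using h1)
      (by simpa [Fin.ext_iff] using h2)
  · rfl

/-- `π̂ T̂_i π̂⁻¹ = T̂_{i+1}`; setting `T̂_0 := π̂ T̂_{N-1} π̂⁻¹`, the operator `T̂_0` satisfies the
quadratic Hecke relation, and for `N ≥ 3` the affine braid relations
`T̂_0 T̂_1 T̂_0 = T̂_1 T̂_0 T̂_1`, `T̂_0 T̂_{N-1} T̂_0 = T̂_{N-1} T̂_0 T̂_{N-1}` and `T̂_0 T̂_j = T̂_j T̂_0`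
(`2 ≤ j ≤ N-2`) hold.  Here `π̂` is the field automorphism of `F` fixing `ℂ` and determined by
`x_i ↦ x_{i+1}` (`1 ≤ i ≤ N-1`) and `x_N ↦ q⁻¹ x_1`; in 0-based labels, `T̂_1, …, T̂_{N-1}`
are `DL 0, …, DL (N-2)` and `T̂_{N-1} = DL (N-2)`, `T̂_j = DL (j-1)`. -/
theorem demazure_lusztig_affine (N : ℕ) (hN : 2 ≤ N) (q : ℝ) (hq0 : 0 < q) (hq1 : q < 1)
    (k : ℂ) (hk : k ≠ 0)
    (act : Equiv.Perm (Fin N) →* RingAut (RatF N)) (hact : IsStdAction N act)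
    (pihat : RingAut (RatF N))
    (hpiX : ∀ (i : ℕ) (h : i + 1 < N),
      pihat (Xv N ⟨i, Nat.lt_of_succ_lt h⟩) = Xv N ⟨i + 1, h⟩)
    (hpiLast : pihat (Xv N ⟨N - 1, by omega⟩) = Cc N ((q : ℂ))⁻¹ * Xv N ⟨0, by omega⟩)
    (hpiC : ∀ c : ℂ, pihat (Cc N c) = Cc N c)
    (T0 : RatF N → RatF N)
    (hT0 : ∀ f, T0 f = pihat (DL N k act (N - 2) (pihat⁻¹ f))) :
    (∀ i, i + 2 < N → ∀ f : RatF N,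
      pihat (DL N k act i (pihat⁻¹ f)) = DL N k act (i + 1) f) ∧
    (∀ f : RatF N,
      T0 (T0 f + Cc N k⁻¹ * f) - Cc N k * (T0 f + Cc N k⁻¹ * f) = 0) ∧
    (3 ≤ N →
      (∀ f : RatF N, T0 (DL N k act 0 (T0 f)) = DL N k act 0 (T0 (DL N k act 0 f))) ∧
      (∀ f : RatF N,
        T0 (DL N k act (N - 2) (T0 f)) = DL N k act (N - 2) (T0 (DL N k act (N - 2) f))) ∧
      (∀ j : ℕ, 2 ≤ j → j ≤ N - 2 → ∀ f : RatF N,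
        T0 (DL N k act (j - 1) f) = DL N k act (j - 1) (T0 f))) := by
  obtain ⟨M, rfl⟩ := Nat.exists_eq_add_of_le' hN
  have hpinv : ∀ f, pihat⁻¹ (pihat f) = f := pihat.symm_apply_apply
  obtain ⟨hactX, hactC⟩ := hact
  have hq : (q : ℂ) ≠ 0 := by exact_mod_cast hq0.ne'
  have hQ : Cc (M + 2) (q : ℂ) * Cc (M + 2) (q : ℂ)⁻¹ = 1 := by
    rw [← Cc_mul, mul_inv_cancel₀ hq, Cc_one]
  have hQ' : Cc (M + 2) (q : ℂ)⁻¹ * Cc (M + 2) (q : ℂ) = 1 := by rw [mul_comm, hQ]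
  have hQne : Cc (M + 2) (q : ℂ)⁻¹ ≠ 0 := right_ne_zero_of_mul_eq_one hQ
  have hpinvC : ∀ c, pihat⁻¹ (Cc (M + 2) c) = Cc (M + 2) c := fun c => by
    conv_lhs => rw [← hpiC c]
    exact hpinv _
  have hpinvX : ∀ (i : ℕ) (h : i + 1 < M + 2),
      pihat⁻¹ (Xv (M + 2) ⟨i + 1, h⟩) = Xv (M + 2) ⟨i, Nat.lt_of_succ_lt h⟩ := fun i h => by
    rw [← hpiX i h, hpinv]
  change pihat (Xv (M + 2) ⟨M + 1, by omega⟩) = _ at hpiLast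
  have hpinv0 : pihat⁻¹ (Xv (M + 2) ⟨0, by omega⟩) =
      Cc (M + 2) (q : ℂ) * Xv (M + 2) ⟨M + 1, by omega⟩ := by
    rw [← hpinv (Cc (M + 2) (q : ℂ) * Xv (M + 2) ⟨M + 1, by omega⟩), map_mul, hpiC, hpiLast,
      ← mul_assoc, hQ, one_mul]
  have hsl : ∀ (i : ℕ) (h : i + 1 < M + 2), act (sw (M + 2) i) (Xv (M + 2) ⟨i, by omega⟩) =
      Xv (M + 2) ⟨i + 1, h⟩ := fun i h => by rw [hactX, sw_apply_left h]
  have hsr : ∀ (i : ℕ) (h : i + 1 < M + 2), act (sw (M + 2) i) (Xv (M + 2) ⟨i + 1, h⟩) =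
      Xv (M + 2) ⟨i, by omega⟩ := fun i h => by rw [hactX, sw_apply_right h]
  have hsn : ∀ (i j : ℕ) (h : j < M + 2), j ≠ i → j ≠ i + 1 →
      act (sw (M + 2) i) (Xv (M + 2) ⟨j, h⟩) = Xv (M + 2) ⟨j, h⟩ := fun i j h h1 h2 => by
    rw [hactX, sw_apply_of_ne h1 h2]
  have hss : ∀ i, act (sw (M + 2) i) * act (sw (M + 2) i) = 1 := fun i => by
    rw [← map_mul, sw_mul_self, map_one]
  have hne : ∀ (i j : ℕ) (hi : i < M + 2) (hj : j < M + 2), i ≠ j →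
      Xv (M + 2) ⟨i, hi⟩ ≠ Xv (M + 2) ⟨j, hj⟩ := fun i j hi hj h =>
    (Xv_injective _).ne (by simpa [Fin.ext_iff] using h)
  have hneC : ∀ (c : ℂ) (i j : ℕ) (hi : i < M + 2) (hj : j < M + 2), i ≠ j →
      Xv (M + 2) ⟨i, hi⟩ ≠ Cc (M + 2) c * Xv (M + 2) ⟨j, hj⟩ := fun c i j hi hj h =>
    Xv_ne_Cc_mul_Xv (by simpa [Fin.ext_iff] using h) c
  obtain ⟨s₀, hs₀⟩ : ∃ s₀, s₀ = pihat * act (sw (M + 2) M) * pihat⁻¹ := ⟨_, rfl⟩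
  have h0C : ∀ c, s₀ (Cc (M + 2) c) = Cc (M + 2) c := fun c => by
    simp only [hs₀, RingAut.mul_apply, hpinvC, hactC, hpiC]
  have h0s : s₀ * s₀ = 1 := by
    have := hss M
    calc s₀ * s₀ = pihat * (act (sw (M + 2) M) * act (sw (M + 2) M)) * pihat⁻¹ := by
          rw [hs₀]; group
      _ = 1 := by rw [this]; group
  have h0l : s₀ (Xv (M + 2) ⟨M + 1, by omega⟩) =
      Cc (M + 2) (q : ℂ)⁻¹ * Xv (M + 2) ⟨0, by omega⟩ := by
    simp only [hs₀, RingAut.mul_apply]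
    rw [hpinvX, hsl M (by omega), hpiLast]
  have h0r : s₀ (Xv (M + 2) ⟨0, by omega⟩) =
      Cc (M + 2) (q : ℂ) * Xv (M + 2) ⟨M + 1, by omega⟩ := by
    simp only [hs₀, RingAut.mul_apply]
    rw [hpinv0, map_mul, map_mul, hactC, hpiC, hsr M (by omega), hpiX M (by omega)]
  have h0n : ∀ (j : ℕ) (h : j < M + 2), j ≠ 0 → j ≠ M + 1 →
      s₀ (Xv (M + 2) ⟨j, h⟩) = Xv (M + 2) ⟨j, h⟩ := fun j h h1 h2 => by
    obtain ⟨i, rfl⟩ := Nat.exists_eq_succ_of_ne_zero h1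
    simp only [hs₀, RingAut.mul_apply]
    rw [hpinvX i h, hsn M i _ (by omega) (by omega), hpiX i h]
  have hT : ∀ f, T0 f = demazureLusztig (Cc (M + 2) k) (Cc (M + 2) k⁻¹) s₀
      (Xv (M + 2) ⟨M + 1, by omega⟩) (Cc (M + 2) (q : ℂ)⁻¹ * Xv (M + 2) ⟨0, by omega⟩) f :=
    fun f => by
      rw [hT0, Nat.add_sub_cancel, DL_eq_demazureLusztig k act (by omega : M + 1 < M + 2),
        map_demazureLusztig pihat (hpiC _) (hpiC _), hpiX M (by omega), hpiLast, hs₀]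
  have h0rQ : s₀ (Cc (M + 2) (q : ℂ)⁻¹ * Xv (M + 2) ⟨0, by omega⟩) =
      Xv (M + 2) ⟨M + 1, by omega⟩ := by
    rw [map_mul, h0C, h0r, ← mul_assoc, hQ', one_mul]
  refine ⟨fun i hi f => ?_, fun f => ?_, fun h3 => ⟨fun f => ?_, fun f => ?_, fun j hj1 hj2 f => ?_⟩⟩
  · have hconj : pihat * act (sw (M + 2) i) * pihat⁻¹ = act (sw (M + 2) (i + 1)) := by
      apply ratF_ringAut_ext
      · intro c
        simp only [RingAut.mul_apply, hpinvC, hactC, hpiC]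
      · rintro ⟨j, hj⟩
        simp only [RingAut.mul_apply]
        rcases j with _ | j
        · rw [hpinv0, map_mul, map_mul, hactC, hpiC, hsn i _ _ (by omega) (by omega), hpiLast,
            ← mul_assoc, hQ, one_mul, hsn (i + 1) _ _ (by omega) (by omega)]
        · rw [hpinvX j hj]
          by_cases h1 : j = i
          · subst h1
            rw [hsl j (by omega), hpiX _ (by omega), hsl (j + 1) (by omega)]
          by_cases h2 : j = i + 1
          · subst h2
            rw [hsr i (by omega), hpiX _ (by omega), hsr (i + 1) (by omega)]
          · rw [hsn i j _ h1 h2, hpiX j hj, hsn (i + 1) _ _ (by omega) (by omega)]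
    rw [DL_eq_demazureLusztig k act (by omega : i + 1 < M + 2),
      DL_eq_demazureLusztig k act (by omega : i + 1 + 1 < M + 2),
      map_demazureLusztig pihat (hpiC _) (hpiC _), hpiX i (by omega), hpiX (i + 1) (by omega),
      hconj]
  · rw [hT, hT]
    exact demazureLusztig_quadratic (h0C _) (h0C _) h0s h0l h0rQ (hneC _ _ _ _ _ (by omega)) f
  · have hD : ∀ g, DL (M + 2) k act 0 g = demazureLusztig (Cc (M + 2) k) (Cc (M + 2) k⁻¹)
        (act (sw (M + 2) 0)) (Cc (M + 2) (q : ℂ)⁻¹ * Xv (M + 2) ⟨0, by omega⟩)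
        (Cc (M + 2) (q : ℂ)⁻¹ * Xv (M + 2) ⟨1, by omega⟩) g := fun g => by
      rw [demazureLusztig_mul_left hQne, DL_eq_demazureLusztig k act (by omega : 0 + 1 < M + 2)]
    have hs01 := hsl 0 (by omega)
    have hs10 := hsr 0 (by omega)
    have hsM := hsn 0 (M + 1) (by omega) (by omega) (by omega)
    have h01 := h0n 1 (by omega) (by omega) (by omega)
    simp only [zero_add] at hs01 hs10
    simp only [hT, hD]
    refine demazureLusztig_braid (h0C _) (h0C _) (hactC _ _) (hactC _ _) h0s (hss 0) ?_ h0l h0rQ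
      ?_ hsM ?_ ?_ (hneC _ _ _ _ _ (by omega)) ?_ (hneC _ _ _ _ _ (by omega)) f
    · apply ratF_ringAut_ext
      · intro c
        simp only [RingAut.mul_apply, hactC, h0C]
      · rintro ⟨j, hj⟩
        simp only [RingAut.mul_apply]
        by_cases h1 : j = 0
        · subst h1
          simp only [map_mul, hactC, h0C, hs01, hs10, hsM, h01, h0l, h0r]
          rw [← mul_assoc, hQ, one_mul]
        by_cases h2 : j = 1
        · subst h2
          simp only [map_mul, hactC, hs10, hsM, h01, h0r]
        by_cases h4 : j = M + 1
        · subst h4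
          simp only [map_mul, hactC, h0C, hs01, hsM, h01, h0l]
        · have e1 := hsn 0 j hj h1 h2
          have e2 := h0n j hj h1 h4
          simp only [e1, e2]
    · rw [map_mul, h0C, h01]
    · rw [map_mul, hactC, hs01]
    · rw [map_mul, hactC, hs10]
    · exact (mul_right_injective₀ hQne).ne (hne _ _ _ _ (by omega))
  · rw [Nat.add_sub_cancel]
    have hM1 := hsl M (by omega)
    have hM2 := hsr M (by omega)
    have hM0 := hsn M 0 (by omega) (by omega) (by omega)
    have h0M := h0n M (by omega) (by omega) (by omega)
    simp only [hT, DL_eq_demazureLusztig k act (by omega : M + 1 < M + 2)]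
    refine (demazureLusztig_braid (hactC _ _) (hactC _ _) (h0C _) (h0C _) (hss M) h0s ?_ hM1 hM2
      ?_ h0M h0l h0rQ (hne _ _ _ _ (by omega)) (hneC _ _ _ _ _ (by omega))
      (hneC _ _ _ _ _ (by omega)) f).symm
    · apply ratF_ringAut_ext
      · intro c
        simp only [RingAut.mul_apply, hactC, h0C]
      · rintro ⟨j, hj⟩
        simp only [RingAut.mul_apply]
        by_cases h1 : j = 0
        · subst h1
          simp only [map_mul, hactC, h0C, hM2, hM0, h0M, h0r]
        by_cases h2 : j = M
        · subst h2
          simp only [map_mul, hactC, hM1, hM0, h0M, h0l]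
        by_cases h4 : j = M + 1
        · subst h4
          simp only [map_mul, hactC, h0C, hM1, hM2, hM0, h0M, h0l, h0r]
          rw [← mul_assoc, hQ', one_mul]
        · have e1 := hsn M j hj h2 h4
          have e2 := h0n j hj h1 h4
          simp only [e1, e2]
    · rw [map_mul, hactC, hM0]
  · obtain ⟨i, rfl⟩ : ∃ i, j = i + 1 := ⟨j - 1, by omega⟩
    rw [Nat.add_sub_cancel]
    have hi1 := hsl i (by omega)
    have hi2 := hsr i (by omega)
    have hi0 := hsn i 0 (by omega) (by omega) (by omega)
    have hiM := hsn i (M + 1) (by omega) (by omega) (by omega)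
    have h0i := h0n i (by omega) (by omega) (by omega)
    have h0i' := h0n (i + 1) (by omega) (by omega) (by omega)
    simp only [hT, DL_eq_demazureLusztig k act (by omega : i + 1 < M + 2)]
    refine demazureLusztig_comm (h0C _) (h0C _) (hactC _ _) (hactC _ _) ?_ h0i h0i' hiM ?_ f
    · apply ratF_ringAut_ext
      · intro c
        simp only [RingAut.mul_apply, hactC, h0C]
      · rintro ⟨j, hj⟩
        simp only [RingAut.mul_apply]
        by_cases h1 : j = 0
        · subst h1
          simp only [map_mul, hactC, hi0, hiM, h0r]
        by_cases h2 : j = M + 1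
        · subst h2
          simp only [map_mul, hactC, hi0, hiM, h0l]
        have e2 := h0n j hj h1 h2
        by_cases h4 : j = i
        · subst h4
          simp only [hi1, e2, h0i']
        by_cases h5 : j = i + 1
        · subst h5
          simp only [hi2, e2, h0i]
        · have e1 := hsn i j hj h4 h5
          simp only [e1, e2]
    · rw [map_mul, hactC, hi0]
end
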